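/- arXiv:math-ph/0308032 — 2 statements merged into one kernel-verified Lean document; each statement's English description precedes it below -/
import Mathlib

section
/- Let V : ℝ → ℂ be continuous, bounded and 2π-periodic, and let z ∈ ℂ. Then the Floquet discriminant of the complex-conjugated potential V̄ (defined by V̄(x) = conj(V(x))) satisfies Δ(V̄; conj(z)) = conj(Δ(V; z)). Consequently, if (a_k)_{k≥1} satisfies Σ_{k=1}^∞ |a_k| < ∞ and W(x) = Σ_{k=1}^∞ a_k e^{−ikx}, then Δ(W; z) = 2cos(2π√z) for all z ∈ ℂ, where √z is any complex square root of z. -/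
noncomputable section

/-- `ψ` is a (twice differentiable) solution of the Hill equation `-ψ'' + V ψ = z ψ` on `ℝ`. -/
def IsHillSolution (V : ℝ → ℂ) (z : ℂ) (ψ : ℝ → ℂ) : Prop :=
  Differentiable ℝ ψ ∧ Differentiable ℝ (deriv ψ) ∧
    ∀ x : ℝ, -deriv (deriv ψ) x + V x * ψ x = z * ψ x

namespace IsHillSolution

theorem hasDerivAt_deriv {V : ℝ → ℂ} {z : ℂ} {f : ℝ → ℂ} (hf : IsHillSolution V z f) (x : ℝ) :
    HasDerivAt (deriv f) ((V x - z) * f x) x := by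
  have h := (hf.2.1 x).hasDerivAt
  have e : deriv (deriv f) x = (V x - z) * f x := by linear_combination -(hf.2.2 x)
  rwa [e] at h

/-- The Wronskian of two solutions of the Hill equation is constant. -/
theorem wronskian_eq {V : ℝ → ℂ} {z : ℂ} {f g : ℝ → ℂ} (hf : IsHillSolution V z f)
    (hg : IsHillSolution V z g) (x : ℝ) :
    f x * deriv g x - deriv f x * g x = f 0 * deriv g 0 - deriv f 0 * g 0 := by
  have h : ∀ t, HasDerivAt (fun t => f t * deriv g t - deriv f t * g t) 0 t := fun t => by
    exact (((hf.1 t).hasDerivAt.fun_mul (hg.hasDerivAt_deriv t)).fun_sub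
      ((hf.hasDerivAt_deriv t).fun_mul (hg.1 t).hasDerivAt)).congr_deriv (by ring)
  exact is_const_of_deriv_eq_zero (fun t => (h t).differentiableAt) (fun t => (h t).deriv) x 0

/-- Every solution is a combination of the fundamental solutions. -/
theorem eq_combination {V : ℝ → ℂ} {z : ℂ} {f c s : ℝ → ℂ} (hf : IsHillSolution V z f)
    (hc : IsHillSolution V z c) (hc0 : c 0 = 1) (hc0' : deriv c 0 = 0)
    (hs : IsHillSolution V z s) (hs0 : s 0 = 0) (hs0' : deriv s 0 = 1) (x : ℝ) :
    f x = f 0 * c x + deriv f 0 * s x ∧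
      deriv f x = f 0 * deriv c x + deriv f 0 * deriv s x := by
  have h₁ := hf.wronskian_eq hs x
  have h₂ := hc.wronskian_eq hf x
  have h₃ := hc.wronskian_eq hs x
  simp only [hc0, hc0', hs0, hs0', mul_one, mul_zero, one_mul, zero_mul, sub_zero] at h₁ h₂ h₃
  constructor
  · linear_combination c x * h₁ + s x * h₂ - f x * h₃
  · linear_combination deriv c x * h₁ + deriv s x * h₂ - deriv f x * h₃

theorem conj {V : ℝ → ℂ} {z : ℂ} {f : ℝ → ℂ} (hf : IsHillSolution V z f) :
    IsHillSolution (fun x => starRingEnd ℂ (V x)) (starRingEnd ℂ z)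
      (fun x => starRingEnd ℂ (f x)) := by
  have h₁ : deriv (fun x => starRingEnd ℂ (f x)) = fun x => starRingEnd ℂ (deriv f x) :=
    deriv.star'
  have h₂ : deriv (fun x => starRingEnd ℂ (deriv f x)) =
      fun x => starRingEnd ℂ (deriv (deriv f) x) := deriv.star'
  refine ⟨fun x => (hf.1 x).star, ?_, fun x => ?_⟩
  · rw [h₁]
    exact fun x => (hf.2.1 x).star
  · rw [h₁, h₂]
    simpa using congrArg (starRingEnd ℂ) (hf.2.2 x)

/-- A nontrivial Floquet solution with multiplier `μ` determines the discriminant. -/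
theorem discriminant_of_multiplier {V : ℝ → ℂ} {z μ : ℂ} {f c s : ℝ → ℂ} {T : ℝ}
    (hf : IsHillSolution V z f) (hμ : ∀ x, f (x + T) = μ * f x) (hne : ∃ x, f x ≠ 0)
    (hc : IsHillSolution V z c) (hc0 : c 0 = 1) (hc0' : deriv c 0 = 0)
    (hs : IsHillSolution V z s) (hs0 : s 0 = 0) (hs0' : deriv s 0 = 1) :
    μ * (c T + deriv s T) = 1 + μ ^ 2 := by
  have hval : f T = μ * f 0 := by simpa using hμ 0
  have hder : deriv f T = μ * deriv f 0 := by
    have h : deriv (fun x => f (x + T)) 0 = deriv (fun x => μ * f x) 0 := by simp only [hμ]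
    rwa [deriv_comp_add_const, zero_add, deriv_const_mul _ (hf.1 0)] at h
  obtain ⟨h₁, h₂⟩ := hf.eq_combination hc hc0 hc0' hs hs0 hs0' T
  have hw := hc.wronskian_eq hs T
  simp only [hc0, hc0', hs0, hs0', mul_one, mul_zero, sub_zero] at hw
  rw [hval] at h₁
  rw [hder] at h₂
  have k₁ : f 0 * (μ * (c T + deriv s T) - (1 + μ ^ 2)) = 0 := by
    linear_combination (deriv s T - μ) * h₁ - s T * h₂ + f 0 * hw
  have k₂ : deriv f 0 * (μ * (c T + deriv s T) - (1 + μ ^ 2)) = 0 := by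
    linear_combination -deriv c T * h₁ + (c T - μ) * h₂ + deriv f 0 * hw
  by_contra hcon
  have hcon' := sub_ne_zero.mpr hcon
  have e₁ := (mul_eq_zero.mp k₁).resolve_right hcon'
  have e₂ := (mul_eq_zero.mp k₂).resolve_right hcon'
  obtain ⟨x, hx⟩ := hne
  apply hx
  rw [(hf.eq_combination hc hc0 hc0' hs hs0 hs0' x).1, e₁, e₂]
  ring

end IsHillSolution

/-- The Fourier coefficients of the periodic factor of a Floquet solution. -/
def floquetCoeff (a : ℕ → ℂ) (w : ℂ) : ℕ → ℂ
  | 0 => 1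
  | n + 1 => -(∑ k : Fin (n + 1), a k * floquetCoeff a w (n - k)) /
      (((n : ℂ) + 1) ^ 2 - 2 * w * ((n : ℂ) + 1))

theorem floquetCoeff_recurrence (a : ℕ → ℂ) {w : ℂ} (hw : ∀ n : ℕ, 2 * w ≠ (n : ℂ) + 1) (n : ℕ) :
    (((n : ℂ) + 1) ^ 2 - 2 * w * ((n : ℂ) + 1)) * floquetCoeff a w (n + 1) =
      -∑ k ∈ Finset.range (n + 1), a k * floquetCoeff a w (n - k) := by
  have h : ((n : ℂ) + 1) ^ 2 - 2 * w * ((n : ℂ) + 1) ≠ 0 := by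
    have h₁ : (n : ℂ) + 1 ≠ 0 := Nat.cast_add_one_ne_zero n
    have h₂ : (n : ℂ) + 1 - 2 * w ≠ 0 := sub_ne_zero.mpr (hw n).symm
    have := mul_ne_zero h₁ h₂
    convert this using 1
    ring
  rw [floquetCoeff, mul_div_cancel₀ _ h, Finset.sum_range fun k => a k * floquetCoeff a w (n - k)]

theorem sum_norm_convolution_le {a : ℕ → ℂ} (c : ℕ → ℂ) (ha : Summable fun k => ‖a k‖) (N : ℕ) :
    ∑ n ∈ Finset.range N, ‖∑ k ∈ Finset.range (n + 1), a k * c (n - k)‖ ≤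
      (∑' k, ‖a k‖) * ∑ n ∈ Finset.range N, ‖c n‖ := by
  calc
    _ ≤ ∑ n ∈ Finset.range N, ∑ k ∈ Finset.range (n + 1), ‖a k‖ * ‖c (n - k)‖ := by
      refine Finset.sum_le_sum fun n _ => (norm_sum_le _ _).trans (le_of_eq ?_)
      simp only [norm_mul]
    _ = ∑ k ∈ Finset.range N, ∑ n ∈ Finset.range (N - k), ‖a k‖ * ‖c n‖ :=
      Finset.sum_range_diag_flip N fun k n => ‖a k‖ * ‖c n‖
    _ ≤ ∑ k ∈ Finset.range N, ‖a k‖ * ∑ n ∈ Finset.range N, ‖c n‖ := by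
      refine Finset.sum_le_sum fun k _ => ?_
      rw [← Finset.mul_sum]
      gcongr
      exact Nat.sub_le N k
    _ = (∑ k ∈ Finset.range N, ‖a k‖) * ∑ n ∈ Finset.range N, ‖c n‖ := by rw [Finset.sum_mul]
    _ ≤ _ := by
      gcongr
      exact ha.sum_le_tsum _ fun _ _ => norm_nonneg _

theorem summable_sq_mul_norm_of_recurrence {a c : ℕ → ℂ} {w : ℂ} (ha : Summable fun k => ‖a k‖)
    (hc : ∀ n : ℕ, (((n : ℂ) + 1) ^ 2 - 2 * w * ((n : ℂ) + 1)) * c (n + 1) =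
      -∑ k ∈ Finset.range (n + 1), a k * c (n - k)) :
    Summable fun n : ℕ => (n : ℝ) ^ 2 * ‖c n‖ := by
  set A : ℝ := ∑' k, ‖a k‖ with hA
  set K : ℝ := 2 * ‖w‖ ^ 2 + A with hK
  have hA0 : 0 ≤ A := tsum_nonneg fun _ => norm_nonneg _
  have hK0 : 0 ≤ K := by positivity
  have hlower : ∀ n : ℕ, (n : ℝ) ^ 2 / 2 - 2 * ‖w‖ ^ 2 ≤ ‖(n : ℂ) ^ 2 - 2 * w * n‖ := fun n => by
    have h := norm_sub_norm_le ((n : ℂ) ^ 2) (2 * w * n)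
    simp only [norm_pow, norm_mul, Complex.norm_natCast, Complex.norm_ofNat] at h
    nlinarith [sq_nonneg ((n : ℝ) - 2 * ‖w‖)]
  have hsum : ∀ N : ℕ, ∑ n ∈ Finset.range (N + 1), ((n : ℝ) ^ 2 / 2 - K) * ‖c n‖ ≤ 0 := fun N => by
    have h₁ : ∑ n ∈ Finset.range (N + 1), ‖(n : ℂ) ^ 2 - 2 * w * n‖ * ‖c n‖ ≤
        A * ∑ n ∈ Finset.range (N + 1), ‖c n‖ := by
      rw [Finset.sum_range_succ']
      simp only [← norm_mul, Nat.cast_add, Nat.cast_one, hc, norm_neg]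
      refine le_trans (le_of_eq ?_) ((sum_norm_convolution_le c ha N).trans
        (mul_le_mul_of_nonneg_left (Finset.sum_le_sum_of_subset_of_nonneg
          (Finset.range_mono N.le_succ) fun _ _ _ => norm_nonneg _) hA0))
      simp
    have h₂ : ∑ n ∈ Finset.range (N + 1), ((n : ℝ) ^ 2 / 2 - K) * ‖c n‖ ≤
        ∑ n ∈ Finset.range (N + 1), (‖(n : ℂ) ^ 2 - 2 * w * n‖ * ‖c n‖ - A * ‖c n‖) := by
      refine Finset.sum_le_sum fun n _ => ?_
      rw [← sub_mul]
      refine mul_le_mul_of_nonneg_right ?_ (norm_nonneg _)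
      linarith [hlower n]
    rw [Finset.sum_sub_distrib, ← Finset.mul_sum] at h₂
    linarith
  obtain ⟨m, hm⟩ := exists_nat_gt (4 * K + 1)
  have hterm : ∀ n : ℕ, (n : ℝ) ^ 2 * ‖c n‖ ≤
      4 * (((n : ℝ) ^ 2 / 2 - K) * ‖c n‖) + if n < m then 4 * K * ‖c n‖ else 0 := fun n => by
    have hcn := norm_nonneg (c n)
    split_ifs with h
    · nlinarith [mul_nonneg (sq_nonneg (n : ℝ)) hcn]
    · have hmn : (m : ℝ) ≤ n := by exact_mod_cast not_lt.mp h
      have : 4 * K ≤ (n : ℝ) ^ 2 := by nlinarith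
      nlinarith [mul_nonneg (sub_nonneg.mpr this) hcn]
  refine summable_of_sum_range_le (c := ∑ n ∈ Finset.range m, 4 * K * ‖c n‖)
    (fun n => by positivity) fun N => ?_
  calc
    _ ≤ ∑ n ∈ Finset.range (N + 1), (n : ℝ) ^ 2 * ‖c n‖ :=
      Finset.sum_le_sum_of_subset_of_nonneg (Finset.range_mono N.le_succ)
        fun _ _ _ => by positivity
    _ ≤ _ := Finset.sum_le_sum fun n _ => hterm n
    _ = 4 * ∑ n ∈ Finset.range (N + 1), ((n : ℝ) ^ 2 / 2 - K) * ‖c n‖ +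
        ∑ n ∈ Finset.range (N + 1) with n < m, 4 * K * ‖c n‖ := by
      rw [Finset.sum_add_distrib, Finset.mul_sum, Finset.sum_filter]
    _ ≤ 4 * 0 + ∑ n ∈ Finset.range m, 4 * K * ‖c n‖ := by
      gcongr
      · exact hsum N
      · intro n hn
        simpa using (Finset.mem_filter.mp hn).2
    _ = _ := by ring

theorem norm_exp_neg_I_mul (n : ℕ) (x : ℝ) : ‖Complex.exp (-(Complex.I * n * x))‖ = 1 := by
  rw [Complex.norm_exp]
  simp

/-- Termwise differentiation of a Fourier series with frequencies `-n`, `n ∈ ℕ`. -/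
theorem hasDerivAt_fourierSeries {c : ℕ → ℂ} (hc : Summable fun n : ℕ => (n : ℝ) * ‖c n‖)
    (hc₀ : Summable fun n => ‖c n‖) (x : ℝ) :
    HasDerivAt (fun x : ℝ => ∑' n : ℕ, c n * Complex.exp (-(Complex.I * n * x)))
      (∑' n : ℕ, -(Complex.I * n) * c n * Complex.exp (-(Complex.I * n * x))) x := by
  refine hasDerivAt_tsum (𝕜 := ℝ) (F := ℂ)
    (g := fun (n : ℕ) (t : ℝ) => c n * Complex.exp (-(Complex.I * n * t)))
    (g' := fun (n : ℕ) (t : ℝ) => -(Complex.I * n) * c n * Complex.exp (-(Complex.I * n * t)))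
    (y₀ := 0) hc (fun n t => ?_) (fun n t => ?_) ?_ x
  · have h : HasDerivAt (fun t : ℝ => -(Complex.I * n * t)) (-(Complex.I * n)) t := by
      simpa using ((hasDerivAt_id t).ofReal_comp.const_mul (Complex.I * n)).fun_neg
    exact (h.cexp.const_mul (c n)).congr_deriv (by ring)
  · simp [norm_exp_neg_I_mul]
  · simpa using hc₀.of_norm

/-- A Fourier series with nonzero mean does not vanish identically. -/
theorem exists_fourierSeries_ne_zero {c : ℕ → ℂ} (hc : Summable fun n => ‖c n‖) (h0 : c 0 ≠ 0) :
    ∃ x : ℝ, ∑' n : ℕ, c n * Complex.exp (-(Complex.I * n * x)) ≠ 0 := by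
  by_contra! hzero
  have hs : HasSum (fun n : ℕ => ∫ x in (0 : ℝ)..2 * Real.pi,
      c n * Complex.exp (-(Complex.I * n * x))) (∫ _ in (0 : ℝ)..2 * Real.pi, (0 : ℂ)) := by
    refine intervalIntegral.hasSum_integral_of_dominated_convergence (fun n _ => ‖c n‖)
      (fun n => ?_) (fun n => ?_) ?_ ?_ ?_
    · exact Continuous.aestronglyMeasurable (by fun_prop)
    · exact Filter.Eventually.of_forall fun x _ => by simp [norm_exp_neg_I_mul]
    · exact Filter.Eventually.of_forall fun _ _ => hc
    · exact intervalIntegrable_const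
    · refine Filter.Eventually.of_forall fun x _ => ?_
      rw [← hzero x]
      refine Summable.hasSum (Summable.of_norm ?_)
      simpa [norm_exp_neg_I_mul] using hc
  have hint : ∀ n : ℕ, n ≠ 0 → ∫ x in (0 : ℝ)..2 * Real.pi,
      c n * Complex.exp (-(Complex.I * n * x)) = 0 := fun n hn => by
    have hne : -(Complex.I * n) ≠ 0 := by simp [hn]
    have hper : Complex.exp (-(Complex.I * n) * (2 * Real.pi : ℝ)) = 1 := by
      rw [Complex.exp_eq_one_iff]
      exact ⟨-n, by push_cast; ring⟩
    have := integral_exp_mul_complex (a := 0) (b := 2 * Real.pi) hne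
    rw [hper] at this
    simp only [neg_mul] at this
    rw [intervalIntegral.integral_const_mul, this]
    simp
  have h := hs.unique (hasSum_single 0 hint)
  simp [h0, Real.pi_ne_zero] at h

/-- Away from resonance, a potential with only negative frequencies has a Floquet solution
with multiplier `exp (2πiw)`. -/
theorem exists_floquetSolution {a : ℕ → ℂ} (ha : Summable fun k => ‖a k‖) {W : ℝ → ℂ}
    (hW : ∀ x : ℝ, W x = ∑' k : ℕ, a k * Complex.exp (-(Complex.I * ((k : ℂ) + 1) * (x : ℂ))))
    {w : ℂ} (hw : ∀ n : ℕ, 2 * w ≠ (n : ℂ) + 1) :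
    ∃ f : ℝ → ℂ, IsHillSolution W (w ^ 2) f ∧
      (∀ x, f (x + 2 * Real.pi) = Complex.exp (2 * Real.pi * w * Complex.I) * f x) ∧
      ∃ x, f x ≠ 0 := by
  set c := floquetCoeff a w with hcdef
  have hrec := floquetCoeff_recurrence a hw
  rw [← hcdef] at hrec
  have hc0 : c 0 = 1 := by rw [hcdef, floquetCoeff]
  have hs₂ : Summable fun n : ℕ => (n : ℝ) ^ 2 * ‖c n‖ :=
    summable_sq_mul_norm_of_recurrence ha hrec
  have hs₁ : Summable fun n : ℕ => (n : ℝ) * ‖c n‖ := by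
    refine hs₂.of_nonneg_of_le (fun n => by positivity) fun n => ?_
    gcongr
    exact_mod_cast Nat.le_self_pow two_ne_zero n
  have hs₀ : Summable fun n : ℕ => ‖c n‖ := by
    rw [← summable_nat_add_iff 1] at hs₁ ⊢
    refine hs₁.of_nonneg_of_le (fun n => norm_nonneg _) fun n => ?_
    refine le_mul_of_one_le_left (norm_nonneg _) ?_
    simp
  have hnorm : ∀ d : ℕ → ℂ, (Summable fun n => ‖d n‖) → ∀ x : ℝ,
      Summable fun n : ℕ => ‖d n * Complex.exp (-(Complex.I * n * x))‖ := fun d hd x => by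
    simpa [norm_exp_neg_I_mul] using hd
  have hs₁' : Summable fun n : ℕ => ‖-(Complex.I * n) * c n‖ := by simpa using hs₁
  have hs₂' : Summable fun n : ℕ => (n : ℝ) * ‖-(Complex.I * n) * c n‖ := by
    simpa [pow_two, mul_assoc] using hs₂
  set g : ℝ → ℂ := fun x => ∑' n : ℕ, c n * Complex.exp (-(Complex.I * n * x)) with hg
  set g₁ : ℝ → ℂ := fun x => ∑' n : ℕ, -(Complex.I * n) * c n *
    Complex.exp (-(Complex.I * n * x)) with hg₁
  set g₂ : ℝ → ℂ := fun x => ∑' n : ℕ, -(Complex.I * n) * (-(Complex.I * n) * c n) *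
    Complex.exp (-(Complex.I * n * x)) with hg₂
  have hdg : ∀ x, HasDerivAt g (g₁ x) x := fun x => hasDerivAt_fourierSeries hs₁ hs₀ x
  have hdg₁ : ∀ x, HasDerivAt g₁ (g₂ x) x := fun x => hasDerivAt_fourierSeries hs₂' hs₁' x
  have hWg : ∀ x, W x * g x = 2 * Complex.I * w * g₁ x + g₂ x := fun x => by
    have hna : Summable fun k : ℕ =>
        ‖a k * Complex.exp (-(Complex.I * ((k : ℂ) + 1) * (x : ℂ)))‖ := by
      refine ha.congr fun k => ?_
      have := norm_exp_neg_I_mul (k + 1) x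
      push_cast at this
      rw [norm_mul, this, mul_one]
    have hn₂ : Summable fun n : ℕ => ‖-(Complex.I * n) * (-(Complex.I * n) * c n)‖ := by
      simpa [pow_two, mul_assoc] using hs₂
    have t₁ := (hnorm _ hs₁' x).of_norm
    have t₂ := (hnorm _ hn₂ x).of_norm
    rw [hW x, hg, tsum_mul_tsum_eq_tsum_sum_range_of_summable_norm hna (hnorm c hs₀ x), hg₁, hg₂,
      ← tsum_mul_left, ← (t₁.mul_left _).tsum_add t₂, ((t₁.mul_left _).add t₂).tsum_eq_zero_add]
    simp only [Nat.cast_zero, mul_zero, neg_zero, zero_mul, add_zero, zero_add]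
    refine tsum_congr fun n => ?_
    have hconv : ∑ k ∈ Finset.range (n + 1),
        a k * Complex.exp (-(Complex.I * ((k : ℂ) + 1) * x)) *
          (c (n - k) * Complex.exp (-(Complex.I * ((n - k : ℕ) : ℂ) * x))) =
        (∑ k ∈ Finset.range (n + 1), a k * c (n - k)) *
          Complex.exp (-(Complex.I * ((n : ℂ) + 1) * x)) := by
      rw [Finset.sum_mul]
      refine Finset.sum_congr rfl fun k hk => ?_
      have hkn : k ≤ n := Nat.lt_succ_iff.mp (Finset.mem_range.mp hk)
      rw [mul_mul_mul_comm, ← Complex.exp_add]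
      congr 2
      push_cast [Nat.cast_sub hkn]
      ring
    rw [hconv, Nat.cast_add, Nat.cast_one]
    linear_combination Complex.exp (-(Complex.I * ((n : ℂ) + 1) * x)) * hrec n +
      (2 * w * ((n : ℂ) + 1) - ((n : ℂ) + 1) ^ 2) * c (n + 1) *
        Complex.exp (-(Complex.I * ((n : ℂ) + 1) * x)) * Complex.I_sq
  have hexp : ∀ x : ℝ, HasDerivAt (fun x : ℝ => Complex.exp (Complex.I * w * x))
      (Complex.exp (Complex.I * w * x) * (Complex.I * w)) x := fun x => by
    have h : HasDerivAt (fun t : ℝ => Complex.I * w * t) (Complex.I * w) x := by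
      simpa using (hasDerivAt_id x).ofReal_comp.const_mul (Complex.I * w)
    exact h.cexp
  set f : ℝ → ℂ := fun x => Complex.exp (Complex.I * w * x) * g x with hf
  have hf₁ : ∀ x : ℝ, HasDerivAt f
      (Complex.exp (Complex.I * w * x) * (Complex.I * w * g x + g₁ x)) x := fun x => by
    exact ((hexp x).fun_mul (hdg x)).congr_deriv (by ring)
  have hf₁' : deriv f = fun x : ℝ =>
      Complex.exp (Complex.I * w * x) * (Complex.I * w * g x + g₁ x) :=
    funext fun x => (hf₁ x).deriv
  have hf₂ : ∀ x : ℝ, HasDerivAt (deriv f) (Complex.exp (Complex.I * w * x) *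
      (-w ^ 2 * g x + 2 * Complex.I * w * g₁ x + g₂ x)) x := fun x => by
    rw [hf₁']
    refine ((hexp x).fun_mul
      (((hdg x).const_mul (Complex.I * w)).fun_add (hdg₁ x))).congr_deriv ?_
    linear_combination (w ^ 2 * g x * Complex.exp (Complex.I * w * x)) * Complex.I_sq
  refine ⟨f, ⟨fun x => (hf₁ x).differentiableAt, fun x => (hf₂ x).differentiableAt,
    fun x => ?_⟩, fun x => ?_, ?_⟩
  · rw [(hf₂ x).deriv, hf]
    linear_combination Complex.exp (Complex.I * w * x) * hWg x
  · have hgper : g (x + 2 * Real.pi) = g x := by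
      refine tsum_congr fun n => ?_
      congr 1
      rw [Complex.exp_eq_exp_iff_exists_int]
      exact ⟨-n, by push_cast; ring⟩
    simp only [hf, hgper]
    rw [← mul_assoc, ← Complex.exp_add]
    congr 2
    push_cast
    ring
  · obtain ⟨x, hx⟩ := exists_fourierSeries_ne_zero hs₀ (by rw [hc0]; exact one_ne_zero)
    exact ⟨x, mul_ne_zero (Complex.exp_ne_zero _) hx⟩

theorem discriminant_of_nonresonant {a : ℕ → ℂ} (ha : Summable fun k => ‖a k‖) {W : ℝ → ℂ}
    (hW : ∀ x : ℝ, W x = ∑' k : ℕ, a k * Complex.exp (-(Complex.I * ((k : ℂ) + 1) * (x : ℂ))))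
    {w : ℂ} (hw : ∀ n : ℕ, 2 * w ≠ (n : ℂ) + 1) {c s : ℝ → ℂ}
    (hc : IsHillSolution W (w ^ 2) c) (hc0 : c 0 = 1) (hc0' : deriv c 0 = 0)
    (hs : IsHillSolution W (w ^ 2) s) (hs0 : s 0 = 0) (hs0' : deriv s 0 = 1) :
    c (2 * Real.pi) + deriv s (2 * Real.pi) = 2 * Complex.cos (2 * (Real.pi : ℂ) * w) := by
  obtain ⟨f, hf, hμ, hne⟩ := exists_floquetSolution ha hW hw
  have h := hf.discriminant_of_multiplier hμ hne hc hc0 hc0' hs hs0 hs0'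
  have hexp : Complex.exp (2 * Real.pi * w * Complex.I) *
      Complex.exp (-(2 * Real.pi * w) * Complex.I) = 1 := by
    rw [← Complex.exp_add, neg_mul, add_neg_cancel, Complex.exp_zero]
  apply mul_left_cancel₀ (Complex.exp_ne_zero (2 * Real.pi * w * Complex.I))
  rw [h, Complex.two_cos]
  linear_combination -hexp

/-- Conjugating the potential conjugates the Floquet discriminant:
`Δ(V̄; z̄) = conj (Δ(V; z))`. Consequently, for `W(x) = ∑_{k=1}^∞ a_k e^{-ikx}` with
`∑|a_k| < ∞` one has `Δ(W;z) = 2 cos(2π√z)` for all `z ∈ ℂ`. -/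
theorem discriminant_conj_and_negative_frequencies
    (V : ℝ → ℂ) (hVcont : Continuous V) (hVbdd : ∃ M : ℝ, ∀ x : ℝ, ‖V x‖ ≤ M)
    (hVper : ∀ x : ℝ, V (x + 2 * Real.pi) = V x)
    (z : ℂ)
    (c₁ s₁ : ℝ → ℂ)
    (hc₁ : IsHillSolution V z c₁) (hc₁0 : c₁ 0 = 1) (hc₁0' : deriv c₁ 0 = 0)
    (hs₁ : IsHillSolution V z s₁) (hs₁0 : s₁ 0 = 0) (hs₁0' : deriv s₁ 0 = 1)
    (c₂ s₂ : ℝ → ℂ)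
    (hc₂ : IsHillSolution (fun x => starRingEnd ℂ (V x)) (starRingEnd ℂ z) c₂)
    (hc₂0 : c₂ 0 = 1) (hc₂0' : deriv c₂ 0 = 0)
    (hs₂ : IsHillSolution (fun x => starRingEnd ℂ (V x)) (starRingEnd ℂ z) s₂)
    (hs₂0 : s₂ 0 = 0) (hs₂0' : deriv s₂ 0 = 1)
    (a : ℕ → ℂ) (ha : Summable fun k => ‖a k‖)
    (W : ℝ → ℂ)
    (hW : ∀ x : ℝ, W x = ∑' k : ℕ, a k * Complex.exp (-(Complex.I * ((k : ℂ) + 1) * (x : ℂ))))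
    (zW w : ℂ) (hw : w ^ 2 = zW)
    (cW sW : ℝ → ℂ)
    (hcW : IsHillSolution W zW cW) (hcW0 : cW 0 = 1) (hcW0' : deriv cW 0 = 0)
    (hsW : IsHillSolution W zW sW) (hsW0 : sW 0 = 0) (hsW0' : deriv sW 0 = 1) :
    c₂ (2 * Real.pi) + deriv s₂ (2 * Real.pi) =
        starRingEnd ℂ (c₁ (2 * Real.pi) + deriv s₁ (2 * Real.pi)) ∧
      cW (2 * Real.pi) + deriv sW (2 * Real.pi) = 2 * Complex.cos (2 * (Real.pi : ℂ) * w) := by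
  constructor
  · have hc := (hc₁.conj.eq_combination hc₂ hc₂0 hc₂0' hs₂ hs₂0 hs₂0' (2 * Real.pi)).1
    have hs := (hs₁.conj.eq_combination hc₂ hc₂0 hc₂0' hs₂ hs₂0 hs₂0' (2 * Real.pi)).2
    have hderiv : ∀ (f : ℝ → ℂ) (x : ℝ),
        deriv (fun x => starRingEnd ℂ (f x)) x = starRingEnd ℂ (deriv f x) :=
      fun f x => deriv.star
    simp only [hderiv, hc₁0, hc₁0', hs₁0, hs₁0', map_one, map_zero, one_mul, zero_mul, add_zero,
      zero_add] at hc hs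
    rw [map_add, hc, hs]
  · subst hw
    by_cases hres : ∀ n : ℕ, 2 * w ≠ (n : ℂ) + 1
    · exact discriminant_of_nonresonant ha hW hres hcW hcW0 hcW0' hsW hsW0 hsW0'
    · push Not at hres
      obtain ⟨m, hm⟩ := hres
      have hneg : ∀ n : ℕ, 2 * -w ≠ (n : ℂ) + 1 := fun n hn => by
        have h : ((m + 1 + (n + 1) : ℕ) : ℂ) = 0 := by
          push_cast
          linear_combination -hm - hn
        exact absurd (Nat.cast_eq_zero.mp h) (by omega)
      rw [← neg_sq] at hcW hsW
      rw [discriminant_of_nonresonant ha hW hneg hcW hcW0 hcW0' hsW hsW0 hsW0', mul_neg,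
        Complex.cos_neg]
end
end

section
/- Let (a_k)_{k≥1} satisfy Σ_{k=1}^∞ |a_k| < ∞ and let V(x) = Σ_{k=1}^∞ a_k e^{ikx}. Then for every nonnegative integer m, the Floquet discriminant satisfies Δ(V; m²) = 2. (Thus all such potentials produce the same periodic spectrum {m² : m = 0, 1, 2, …} for the problem on [0, 2π] with periodic boundary conditions.) -/
noncomputable section

/-- The coefficients of the Frobenius solution `∑ cₙ e^{i(m+n)x}` with `c₀ = 1`. -/
def frobeniusCoeff (a : ℕ → ℂ) (m : ℕ) : ℕ → ℂ
  | 0 => 1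
  | n + 1 => -(∑ j : Fin (n + 1), a (n - j) * frobeniusCoeff a m j) /
      (((n : ℂ) + 1) * ((n : ℂ) + 1 + 2 * m))
decreasing_by exact j.2

theorem frobeniusCoeff_succ (a : ℕ → ℂ) (m n : ℕ) :
    ((n : ℂ) + 1) * ((n : ℂ) + 1 + 2 * m) * frobeniusCoeff a m (n + 1) =
      -∑ p ∈ Finset.HasAntidiagonal.antidiagonal n, frobeniusCoeff a m p.1 * a p.2 := by
  have h1 : ((n : ℂ) + 1) ≠ 0 := by exact_mod_cast Nat.succ_ne_zero n
  have h2 : ((n : ℂ) + 1 + 2 * m) ≠ 0 := by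
    have : (n + 1 + 2 * m : ℕ) ≠ 0 := by omega
    exact_mod_cast this
  rw [frobeniusCoeff, mul_div_cancel₀ _ (mul_ne_zero h1 h2),
    Finset.Nat.sum_antidiagonal_eq_sum_range_succ (fun i j => frobeniusCoeff a m i * a j) n,
    ← Fin.sum_univ_eq_sum_range (fun j => frobeniusCoeff a m j * a (n - j))]
  simp only [mul_comm]

theorem norm_frobeniusCoeff_succ (a : ℕ → ℂ) (m n : ℕ) :
    ((n : ℝ) + 1) * ((n : ℝ) + 1 + 2 * m) * ‖frobeniusCoeff a m (n + 1)‖ =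
      ‖∑ p ∈ Finset.HasAntidiagonal.antidiagonal n, frobeniusCoeff a m p.1 * a p.2‖ := by
  have h := congrArg norm (frobeniusCoeff_succ a m n)
  have h1 : ‖((n : ℂ) + 1)‖ = (n : ℝ) + 1 := by
    exact_mod_cast Complex.norm_natCast (n + 1)
  have h2 : ‖((n : ℂ) + 1 + 2 * m)‖ = (n : ℝ) + 1 + 2 * m := by
    exact_mod_cast Complex.norm_natCast (n + 1 + 2 * m)
  rwa [norm_neg, norm_mul, norm_mul, h1, h2] at h

theorem sq_mul_norm_frobeniusCoeff_succ_le {a : ℕ → ℂ} (ha : Summable fun k => ‖a k‖) (m n : ℕ)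
    {M : ℝ} (hM : ∀ j ≤ n, ‖frobeniusCoeff a m j‖ ≤ M) :
    ((n : ℝ) + 1) ^ 2 * ‖frobeniusCoeff a m (n + 1)‖ ≤ M * ∑' k, ‖a k‖ := by
  have hM0 : 0 ≤ M := (norm_nonneg _).trans (hM 0 (Nat.zero_le n))
  calc ((n : ℝ) + 1) ^ 2 * ‖frobeniusCoeff a m (n + 1)‖
      ≤ ((n : ℝ) + 1) * ((n : ℝ) + 1 + 2 * m) * ‖frobeniusCoeff a m (n + 1)‖ := by
        have h : (n : ℝ) + 1 ≤ (n : ℝ) + 1 + 2 * m := le_add_of_nonneg_right (by positivity)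
        rw [sq]
        exact mul_le_mul_of_nonneg_right (mul_le_mul_of_nonneg_left h (by positivity))
          (norm_nonneg _)
    _ = ‖∑ p ∈ Finset.HasAntidiagonal.antidiagonal n, frobeniusCoeff a m p.1 * a p.2‖ :=
        norm_frobeniusCoeff_succ a m n
    _ ≤ ∑ p ∈ Finset.HasAntidiagonal.antidiagonal n, M * ‖a p.2‖ := by
        refine norm_sum_le_of_le _ fun p hp => ?_
        rw [norm_mul]
        gcongr
        exact hM _ (le_of_le_of_eq (Nat.le_add_right _ _)
          (Finset.HasAntidiagonal.mem_antidiagonal.1 hp))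
    _ = M * ∑ k ∈ Finset.range (n + 1), ‖a k‖ := by
        rw [← Finset.mul_sum, ← Finset.Nat.sum_antidiagonal_swap]
        simp only [Prod.snd_swap]
        rw [Finset.Nat.sum_antidiagonal_eq_sum_range_succ (fun i _ => ‖a i‖) n]
    _ ≤ M * ∑' k, ‖a k‖ := by
        gcongr
        exact ha.sum_le_tsum _ fun _ _ => norm_nonneg _

theorem exists_norm_frobeniusCoeff_le {a : ℕ → ℂ} (ha : Summable fun k => ‖a k‖) (m : ℕ) :
    ∃ M, ∀ n, ‖frobeniusCoeff a m n‖ ≤ M := by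
  obtain ⟨N, hN⟩ := exists_nat_ge (∑' k, ‖a k‖)
  refine ⟨∑ j ∈ Finset.range (N + 1), ‖frobeniusCoeff a m j‖, fun n => ?_⟩
  induction n using Nat.strong_induction_on with
  | _ n ih =>
    rcases Nat.lt_or_ge n (N + 1) with h | h
    · exact Finset.single_le_sum (f := fun j => ‖frobeniusCoeff a m j‖)
        (fun _ _ => norm_nonneg _) (Finset.mem_range.2 h)
    · obtain ⟨k, rfl⟩ : ∃ k, n = k + 1 := ⟨n - 1, by omega⟩
      have hk := sq_mul_norm_frobeniusCoeff_succ_le ha m k fun j hj => ih j (by omega)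
      have hNk : (N : ℝ) ≤ k := by exact_mod_cast (by omega : N ≤ k)
      have hk0 : (0 : ℝ) ≤ k := k.cast_nonneg
      have hM0 : 0 ≤ ∑ j ∈ Finset.range (N + 1), ‖frobeniusCoeff a m j‖ :=
        Finset.sum_nonneg fun _ _ => norm_nonneg _
      have hle : ∑' k, ‖a k‖ ≤ ((k : ℝ) + 1) ^ 2 := by nlinarith
      refine le_of_mul_le_mul_left (hk.trans ?_) (by positivity : (0 : ℝ) < ((k : ℝ) + 1) ^ 2)
      rw [mul_comm]
      gcongr

theorem summable_norm_frobeniusCoeff {a : ℕ → ℂ} (ha : Summable fun k => ‖a k‖) (m : ℕ) :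
    Summable fun n => ‖frobeniusCoeff a m n‖ := by
  obtain ⟨M, hM⟩ := exists_norm_frobeniusCoeff_le ha m
  rw [← summable_nat_add_iff 1]
  have hs : Summable fun n : ℕ => (M * ∑' k, ‖a k‖) * (1 / ((n + 1 : ℕ) : ℝ) ^ 2) :=
    ((summable_nat_add_iff 1).2 (Real.summable_one_div_nat_pow.2 one_lt_two)).mul_left _
  refine hs.of_nonneg_of_le (fun _ => norm_nonneg _) fun n => ?_
  have h := sq_mul_norm_frobeniusCoeff_succ_le ha m n fun j _ => hM j
  rw [mul_one_div, le_div_iff₀ (by positivity), mul_comm]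
  push_cast
  exact h

theorem summable_sq_mul_norm_frobeniusCoeff {a : ℕ → ℂ} (ha : Summable fun k => ‖a k‖) (m : ℕ) :
    Summable fun n : ℕ => ((m : ℝ) + n) ^ 2 * ‖frobeniusCoeff a m n‖ := by
  have hc := summable_norm_frobeniusCoeff ha m
  rw [← summable_nat_add_iff 1]
  have h := (summable_norm_sum_mul_antidiagonal_of_summable_norm hc ha).add
    (((summable_nat_add_iff 1).2 hc).mul_left ((m : ℝ) ^ 2))
  refine h.congr fun n => ?_
  rw [← norm_frobeniusCoeff_succ]
  push_cast
  ring

/-- Termwise differentiation of `∑ bₙ e^{i(m+n)x}`. -/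
theorem hasDerivAt_tsum_mul_cexp {b : ℕ → ℂ} {m : ℕ}
    (hb : Summable fun n => ‖b n‖) (hb' : Summable fun n : ℕ => ((m : ℝ) + n) * ‖b n‖) (x : ℝ) :
    HasDerivAt (fun x : ℝ => ∑' n : ℕ, b n * Complex.exp (Complex.I * ((m : ℂ) + n) * x))
      (∑' n : ℕ, (Complex.I * ((m : ℂ) + n) * b n) *
        Complex.exp (Complex.I * ((m : ℂ) + n) * x)) x := by
  have hnorm (n : ℕ) (y : ℝ) : ‖Complex.exp (Complex.I * ((m : ℂ) + n) * y)‖ = 1 := by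
    rw [show Complex.I * ((m : ℂ) + n) * y = (((m + n : ℝ) * y : ℝ) : ℂ) * Complex.I by
      push_cast; ring, Complex.norm_exp_ofReal_mul_I]
  refine hasDerivAt_tsum (𝕜 := ℝ) (y₀ := 0)
    (g := fun (n : ℕ) (x : ℝ) => b n * Complex.exp (Complex.I * ((m : ℂ) + n) * x))
    (g' := fun (n : ℕ) (x : ℝ) => (Complex.I * ((m : ℂ) + n) * b n) *
      Complex.exp (Complex.I * ((m : ℂ) + n) * x)) hb' (fun n y => ?_) (fun n y => ?_) ?_ x
  · have h : HasDerivAt (fun y : ℝ => Complex.I * ((m : ℂ) + n) * (y : ℂ))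
        (Complex.I * ((m : ℂ) + n)) y := by
      simpa using (Complex.ofRealCLM.hasDerivAt (x := y)).const_mul (Complex.I * ((m : ℂ) + n))
    exact (h.cexp.const_mul (b n)).congr_deriv (by ring)
  · rw [norm_mul, hnorm, norm_mul, norm_mul, Complex.norm_I, mul_one, one_mul]
    gcongr
    exact_mod_cast (Complex.norm_natCast (m + n)).le
  · refine Summable.of_norm ?_
    simpa only [norm_mul, hnorm, mul_one] using hb

/-- The periodic solution `∑ cₙ e^{i(m+n)x}`. -/
def frobeniusSolution (a : ℕ → ℂ) (m : ℕ) (x : ℝ) : ℂ :=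
  ∑' n : ℕ, frobeniusCoeff a m n * Complex.exp (Complex.I * ((m : ℂ) + n) * x)

theorem hasDerivAt_frobeniusSolution {a : ℕ → ℂ} (ha : Summable fun k => ‖a k‖) (m : ℕ) (x : ℝ) :
    HasDerivAt (frobeniusSolution a m)
      (∑' n : ℕ, (Complex.I * ((m : ℂ) + n) * frobeniusCoeff a m n) *
        Complex.exp (Complex.I * ((m : ℂ) + n) * x)) x := by
  refine hasDerivAt_tsum_mul_cexp (summable_norm_frobeniusCoeff ha m) ?_ x
  refine (summable_sq_mul_norm_frobeniusCoeff ha m).of_nonneg_of_le (fun n => by positivity)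
    fun n => ?_
  gcongr
  exact_mod_cast Nat.le_self_pow two_ne_zero (m + n)

theorem hasDerivAt_deriv_frobeniusSolution {a : ℕ → ℂ} (ha : Summable fun k => ‖a k‖)
    (m : ℕ) (x : ℝ) :
    HasDerivAt (deriv (frobeniusSolution a m))
      (∑' n : ℕ, (Complex.I * ((m : ℂ) + n) * (Complex.I * ((m : ℂ) + n) *
        frobeniusCoeff a m n)) * Complex.exp (Complex.I * ((m : ℂ) + n) * x)) x := by
  rw [show deriv (frobeniusSolution a m) = _ from
    funext fun y => (hasDerivAt_frobeniusSolution ha m y).deriv]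
  have hnorm (n : ℕ) : ‖Complex.I * ((m : ℂ) + n) * frobeniusCoeff a m n‖ =
      ((m : ℝ) + n) * ‖frobeniusCoeff a m n‖ := by
    rw [norm_mul, norm_mul, Complex.norm_I, one_mul]
    congr 1
    exact_mod_cast Complex.norm_natCast (m + n)
  refine hasDerivAt_tsum_mul_cexp ?_ ?_ x
  · refine (summable_sq_mul_norm_frobeniusCoeff ha m).of_nonneg_of_le (fun n => norm_nonneg _)
      fun n => ?_
    rw [hnorm]
    gcongr
    exact_mod_cast Nat.le_self_pow two_ne_zero (m + n)
  · refine (summable_sq_mul_norm_frobeniusCoeff ha m).congr fun n => ?_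
    rw [hnorm]
    ring

theorem isHillSolution_frobeniusSolution {a : ℕ → ℂ} (ha : Summable fun k => ‖a k‖)
    {V : ℝ → ℂ}
    (hV : ∀ x : ℝ, V x = ∑' k : ℕ, a k * Complex.exp (Complex.I * ((k : ℂ) + 1) * (x : ℂ)))
    (m : ℕ) : IsHillSolution V ((m : ℂ) ^ 2) (frobeniusSolution a m) := by
  refine ⟨fun x => (hasDerivAt_frobeniusSolution ha m x).differentiableAt,
    fun x => (hasDerivAt_deriv_frobeniusSolution ha m x).differentiableAt, fun x => ?_⟩
  set c := frobeniusCoeff a m with hc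
  have hnorm (n : ℕ) : ‖Complex.exp (Complex.I * ((m : ℂ) + n) * x)‖ = 1 := by
    rw [show Complex.I * ((m : ℂ) + n) * x = (((m + n : ℝ) * x : ℝ) : ℂ) * Complex.I by
      push_cast; ring, Complex.norm_exp_ofReal_mul_I]
  have hnorm' (n : ℕ) : ‖Complex.exp (Complex.I * ((n : ℂ) + 1) * x)‖ = 1 := by
    rw [show Complex.I * ((n : ℂ) + 1) * x = (((n + 1 : ℝ) * x : ℝ) : ℂ) * Complex.I by
      push_cast; ring, Complex.norm_exp_ofReal_mul_I]
  have hcs : Summable fun n : ℕ => ‖c n * Complex.exp (Complex.I * ((m : ℂ) + n) * x)‖ := by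
    simpa only [norm_mul, hnorm, mul_one] using summable_norm_frobeniusCoeff ha m
  have has : Summable fun n : ℕ => ‖a n * Complex.exp (Complex.I * ((n : ℂ) + 1) * x)‖ := by
    simpa only [norm_mul, hnorm', mul_one] using ha
  have hsq : Summable fun n : ℕ => ((m : ℂ) + n) ^ 2 * c n *
      Complex.exp (Complex.I * ((m : ℂ) + n) * x) := by
    refine Summable.of_norm ((summable_sq_mul_norm_frobeniusCoeff ha m).congr fun n => ?_)
    rw [norm_mul, norm_mul, hnorm, mul_one, norm_pow]
    congr 2
    exact_mod_cast (Complex.norm_natCast (m + n)).symm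
  have hprod : V x * frobeniusSolution a m x =
      ∑' n : ℕ, -(((n : ℂ) + 1) * ((n : ℂ) + 1 + 2 * m) * c (n + 1)) *
        Complex.exp (Complex.I * ((m : ℂ) + (n + 1 : ℕ)) * x) := by
    rw [hV, mul_comm, frobeniusSolution,
      tsum_mul_tsum_eq_tsum_sum_antidiagonal_of_summable_norm hcs has]
    refine tsum_congr fun n => ?_
    rw [hc, frobeniusCoeff_succ, neg_neg, Finset.sum_mul]
    refine Finset.sum_congr rfl fun p hp => ?_
    rw [← Finset.HasAntidiagonal.mem_antidiagonal.1 hp, mul_mul_mul_comm, ← Complex.exp_add]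
    congr 2
    push_cast
    ring
  have hsplit : ∑' n : ℕ, (((m : ℂ) + n) ^ 2 - (m : ℂ) ^ 2) *
      (c n * Complex.exp (Complex.I * ((m : ℂ) + n) * x)) = -(V x * frobeniusSolution a m x) := by
    rw [hprod, ← tsum_neg, Summable.tsum_eq_zero_add]
    · rw [Nat.cast_zero, add_zero, sub_self, zero_mul, zero_add]
      refine tsum_congr fun n => ?_
      push_cast
      ring
    · refine (hsq.sub (hcs.of_norm.mul_left ((m : ℂ) ^ 2))).congr fun n => ?_
      ring
  have hlhs : -deriv (deriv (frobeniusSolution a m)) x =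
      ∑' n : ℕ, ((m : ℂ) + n) ^ 2 * c n * Complex.exp (Complex.I * ((m : ℂ) + n) * x) := by
    rw [(hasDerivAt_deriv_frobeniusSolution ha m x).deriv, ← tsum_neg]
    refine tsum_congr fun n => ?_
    linear_combination (-((m : ℂ) + n) ^ 2 * c n *
      Complex.exp (Complex.I * ((m : ℂ) + n) * x)) * Complex.I_sq
  have hdiff : ∑' n : ℕ, (((m : ℂ) + n) ^ 2 - (m : ℂ) ^ 2) *
      (c n * Complex.exp (Complex.I * ((m : ℂ) + n) * x)) =
      -deriv (deriv (frobeniusSolution a m)) x - (m : ℂ) ^ 2 * frobeniusSolution a m x := by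
    rw [hlhs, frobeniusSolution, ← tsum_mul_left, ← hsq.tsum_sub (hcs.of_norm.mul_left _)]
    refine tsum_congr fun n => ?_
    ring
  linear_combination hsplit - hdiff

theorem frobeniusSolution_periodic (a : ℕ → ℂ) (m : ℕ) :
    Function.Periodic (frobeniusSolution a m) (2 * Real.pi) := by
  intro x
  refine tsum_congr fun n => ?_
  congr 1
  rw [← Complex.exp_periodic.nat_mul (m + n) (Complex.I * ((m : ℂ) + n) * x)]
  congr 1
  push_cast
  ring

theorem frobeniusSolution_ne_zero {a : ℕ → ℂ} (ha : Summable fun k => ‖a k‖) (m : ℕ) :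
    frobeniusSolution a m ≠ 0 := by
  intro h0
  have hint (n : ℕ) : ∫ x in (0 : ℝ)..(2 * Real.pi),
      frobeniusCoeff a m n * Complex.exp (Complex.I * n * x) =
        if n = 0 then (2 * Real.pi : ℂ) else 0 := by
    split_ifs with h
    · subst h
      simp [frobeniusCoeff]
    · rw [intervalIntegral.integral_const_mul, integral_exp_mul_complex (by simp [h])]
      have : Complex.exp (Complex.I * n * ((2 * Real.pi : ℝ) : ℂ)) = 1 := by
        rw [← Complex.exp_nat_mul_two_pi_mul_I n]
        congr 1
        push_cast
        ring
      rw [this]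
      simp
  have hsum := intervalIntegral.hasSum_intervalIntegral_of_summable_norm
    (a := 0) (b := 2 * Real.pi)
    (f := fun n : ℕ => (⟨fun x : ℝ => frobeniusCoeff a m n * Complex.exp (Complex.I * n * x),
      by fun_prop⟩ : C(ℝ, ℂ)))
    (by
      refine (summable_norm_frobeniusCoeff ha m).of_nonneg_of_le (fun _ => norm_nonneg _)
        fun n => ?_
      refine (ContinuousMap.norm_le _ (norm_nonneg _)).2 fun x => ?_
      have hn : ‖Complex.exp (Complex.I * n * (x : ℝ))‖ = 1 := by
        rw [show Complex.I * n * ((x : ℝ) : ℂ) = ((n * (x : ℝ) : ℝ) : ℂ) * Complex.I by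
          push_cast; ring, Complex.norm_exp_ofReal_mul_I]
      simp [hn])
  have hzero (x : ℝ) : ∑' n : ℕ, frobeniusCoeff a m n * Complex.exp (Complex.I * n * x) = 0 := by
    have hx := congrFun h0 x
    rw [frobeniusSolution] at hx
    have hmul : Complex.exp (Complex.I * m * x) *
        ∑' n : ℕ, frobeniusCoeff a m n * Complex.exp (Complex.I * n * x) = 0 := by
      rw [← tsum_mul_left, ← show _ = (0 : ℂ) from hx]
      refine tsum_congr fun n => ?_
      rw [mul_left_comm, ← Complex.exp_add]
      congr 2
      ring
    exact (mul_eq_zero.1 hmul).resolve_left (Complex.exp_ne_zero _)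
  simp only [ContinuousMap.coe_mk, hint, hzero, intervalIntegral.integral_zero] at hsum
  have := hsum.unique (hasSum_ite_eq 0 (2 * Real.pi : ℂ))
  simp [Real.pi_ne_zero] at this

/-- The Wronskian of two solutions of the same Hill equation is constant. -/
theorem IsHillSolution.wronskian_eq_s18 {V : ℝ → ℂ} {z : ℂ} {f g : ℝ → ℂ}
    (hf : IsHillSolution V z f) (hg : IsHillSolution V z g) (x y : ℝ) :
    f x * deriv g x - deriv f x * g x = f y * deriv g y - deriv f y * g y := by
  obtain ⟨hf1, hf2, hf3⟩ := hf
  obtain ⟨hg1, hg2, hg3⟩ := hg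
  have h (t : ℝ) : HasDerivAt (fun t => f t * deriv g t - deriv f t * g t) 0 t := by
    refine (((hf1 t).hasDerivAt.mul (hg2 t).hasDerivAt).sub
      ((hf2 t).hasDerivAt.mul (hg1 t).hasDerivAt)).congr_deriv ?_
    linear_combination g t * hf3 t - f t * hg3 t
  exact is_const_of_deriv_eq_zero (fun t => (h t).differentiableAt) (fun t => (h t).deriv) x y

/-- For `V(x) = ∑_{k=1}^∞ a_k e^{ikx}` with `∑|a_k| < ∞`, all nonnegative integers `m`
satisfy `Δ(V; m²) = 2`, i.e. the periodic spectrum is `{m² : m = 0, 1, 2, …}`. -/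
theorem discriminant_at_squares_eq_two
    (a : ℕ → ℂ) (ha : Summable fun k => ‖a k‖)
    (V : ℝ → ℂ)
    (hV : ∀ x : ℝ, V x = ∑' k : ℕ, a k * Complex.exp (Complex.I * ((k : ℂ) + 1) * (x : ℂ)))
    (m : ℕ)
    (c s : ℝ → ℂ)
    (hc : IsHillSolution V ((m : ℂ) ^ 2) c) (hc0 : c 0 = 1) (hc0' : deriv c 0 = 0)
    (hs : IsHillSolution V ((m : ℂ) ^ 2) s) (hs0 : s 0 = 0) (hs0' : deriv s 0 = 1) :
    c (2 * Real.pi) + deriv s (2 * Real.pi) = 2 := by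
  set ψ := frobeniusSolution a m with hψdef
  have hψ : IsHillSolution V ((m : ℂ) ^ 2) ψ := isHillSolution_frobeniusSolution ha hV m
  have hper : ψ (2 * Real.pi) = ψ 0 := by
    simpa using frobeniusSolution_periodic a m 0
  have hper' : deriv ψ (2 * Real.pi) = deriv ψ 0 := by
    rw [← zero_add (2 * Real.pi), ← deriv_comp_add_const,
      show (fun x => ψ (x + 2 * Real.pi)) = ψ from funext (frobeniusSolution_periodic a m)]
  have hψc := hψ.wronskian_eq_s18 hc (2 * Real.pi) 0
  have hψs := hψ.wronskian_eq_s18 hs (2 * Real.pi) 0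
  have hcs := hc.wronskian_eq_s18 hs (2 * Real.pi) 0
  rw [hper, hper', hc0, hc0'] at hψc
  rw [hper, hper', hs0, hs0'] at hψs
  rw [hc0, hc0', hs0, hs0'] at hcs
  have hdata : ψ 0 ≠ 0 ∨ deriv ψ 0 ≠ 0 := by
    by_contra! h
    refine frobeniusSolution_ne_zero ha m (funext fun x => ?_)
    have h1 := hψ.wronskian_eq_s18 hc x 0
    have h2 := hψ.wronskian_eq_s18 hs x 0
    have h3 := hc.wronskian_eq_s18 hs x 0
    rw [h.1, h.2] at h1 h2
    rw [hc0, hc0', hs0, hs0'] at h3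
    rw [← hψdef, Pi.zero_apply]
    linear_combination c x * h2 - s x * h1 - ψ x * h3
  rcases hdata with hp | hq
  · refine sub_eq_zero.1 ((mul_eq_zero.1 ?_).resolve_left hp)
    linear_combination ψ 0 * hcs + (1 - c (2 * Real.pi)) * hψs + s (2 * Real.pi) * hψc
  · refine sub_eq_zero.1 ((mul_eq_zero.1 ?_).resolve_left hq)
    linear_combination deriv ψ 0 * hcs + (deriv s (2 * Real.pi) - 1) * hψc -
      deriv c (2 * Real.pi) * hψs
end
end
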